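/- For any two invertible elements x, y of J, the elements x⁻¹ − y⁻¹ and x − y have the same rank. Consequently the transversality index μ(x,y) = r − rank(x−y) is invariant under the inversion z ↦ −z⁻¹ (wherever defined), as it is under translations and under the group L; hence μ is invariant under all conformal transformations of J defined at x and y. -/

import Mathlib

open scoped BigOperators Classical

/-- Bare data of a (real) Jordan algebra: a bilinear product and a unit element. -/
structure JordanData (J : Type) [AddCommGroup J] [Module ℝ J] where
  mul : J →ₗ[ℝ] J →ₗ[ℝ] J
  e : J

namespace JordanData

variable {J : Type} [AddCommGroup J] [Module ℝ J] (A : JordanData J)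

/-- `c` is an idempotent. -/
def IsIdem (c : J) : Prop := A.mul c c = c

/-- `c` is a primitive idempotent: a nonzero idempotent which dominates only `0` and itself. -/
def IsPrimitive (c : J) : Prop :=
  A.IsIdem c ∧ c ≠ 0 ∧ ∀ d : J, A.IsIdem d → A.mul c d = d → d = 0 ∨ d = c

/-- A Jordan frame: a complete system of pairwise orthogonal primitive idempotents. -/
def IsFrame {m : ℕ} (c : Fin m → J) : Prop :=
  (∀ j, A.IsPrimitive (c j)) ∧ (∀ i j, i ≠ j → A.mul (c i) (c j) = 0) ∧ ∑ j, c j = A.e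

end JordanData

/-- A simple Euclidean Jordan algebra of rank `rank`, together with its trace `tr`
and determinant `jdet` (characterized by their values on spectral decompositions). -/
structure EJA (J : Type) [NormedAddCommGroup J] [NormedSpace ℝ J] [FiniteDimensional ℝ J]
    extends JordanData J where
  comm : ∀ x y : J, mul x y = mul y x
  unit_mul : ∀ x : J, mul e x = x
  jordan : ∀ x y : J, mul (mul x x) (mul x y) = mul x (mul (mul x x) y)
  tr : J →ₗ[ℝ] ℝ
  tr_posdef : ∀ x : J, x ≠ 0 → 0 < tr (mul x x)
  simple : ∀ I : Submodule ℝ J, (∀ x ∈ I, ∀ y : J, mul y x ∈ I) → I = ⊥ ∨ I = ⊤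
  rank : ℕ
  spectral : ∀ x : J, ∃ (c : Fin rank → J) (lam : Fin rank → ℝ),
    toJordanData.IsFrame c ∧ x = ∑ j, lam j • c j
  tr_prim : ∀ c : J, toJordanData.IsPrimitive c → tr c = 1
  jdet : J → ℝ
  jdet_frame : ∀ (c : Fin rank → J) (lam : Fin rank → ℝ),
    toJordanData.IsFrame c → jdet (∑ j, lam j • c j) = ∏ j, lam j

namespace EJA

variable {J : Type} [NormedAddCommGroup J] [NormedSpace ℝ J] [FiniteDimensional ℝ J]

def IsIdem (A : EJA J) (c : J) : Prop := A.toJordanData.IsIdem c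

def IsPrimitive (A : EJA J) (c : J) : Prop := A.toJordanData.IsPrimitive c

def IsFrame (A : EJA J) {m : ℕ} (c : Fin m → J) : Prop := A.toJordanData.IsFrame c

/-- `x` has rank `k`: in a spectral decomposition of `x`, exactly `k` eigenvalues are nonzero. -/
def HasRank (A : EJA J) (x : J) (k : ℕ) : Prop :=
  ∃ (c : Fin A.rank → J) (lam : Fin A.rank → ℝ), A.IsFrame c ∧
    x = ∑ j, lam j • c j ∧ (Finset.univ.filter fun j => lam j ≠ 0).card = k

/-- The symmetric cone `Ω`: the interior of the set of squares. -/
def cone (A : EJA J) : Set J := interior {x : J | ∃ y : J, x = A.mul y y}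

/-- The Peirce space `J(c,t)`, i.e. the `t`-eigenspace of the multiplication operator `L(c)`. -/
def peirce (A : EJA J) (c : J) (t : ℝ) : Submodule ℝ J :=
  LinearMap.ker (A.mul c - t • (LinearMap.id : J →ₗ[ℝ] J))

/-- The symmetric cone of the Jordan subalgebra `J(c,t)` (`t = 1` or `t = 0`):
the relative interior, within `J(c,t)`, of the set of squares of elements of `J(c,t)`. -/
def subCone (A : EJA J) (c : J) (t : ℝ) : Set J :=
  {x : J | x ∈ A.peirce c t ∧ ∃ U : Set J, IsOpen U ∧ x ∈ U ∧
    ∀ y ∈ U, y ∈ A.peirce c t → ∃ w ∈ A.peirce c t, y = A.mul w w}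

/-- Powers in the Jordan algebra, with `x ^ 0 = e`. -/
def pow (A : EJA J) (x : J) : ℕ → J
  | 0 => A.e
  | n + 1 => A.mul x (A.pow x n)

/-- `y` is the Jordan inverse of `x`: `y` lies in the subalgebra `ℝ[x]` and `x·y = e`. -/
def IsInverse (A : EJA J) (x y : J) : Prop :=
  y ∈ Submodule.span ℝ (Set.range (A.pow x)) ∧ A.mul x y = A.e

/-- The set of invertible linear maps preserving the symmetric cone. -/
def conePreserving (A : EJA J) : Set (J →L[ℝ] J)ˣ :=
  {g | (g : J →L[ℝ] J) '' A.cone = A.cone}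

theorem one_mem_conePreserving (A : EJA J) : 1 ∈ A.conePreserving := by
  show (↑(1 : (J →L[ℝ] J)ˣ) : J →L[ℝ] J) '' A.cone = A.cone
  simp

/-- The group `L`: the identity component of the group of linear transformations of `J`
preserving the symmetric cone `Ω`. -/
def Lgroup (A : EJA J) : Set (J →L[ℝ] J)ˣ :=
  {g | ∃ h : g ∈ A.conePreserving,
    (⟨g, h⟩ : A.conePreserving) ∈ connectedComponent ⟨1, A.one_mem_conePreserving⟩}

end EJA

namespace EJA

variable {J : Type} [NormedAddCommGroup J] [NormedSpace ℝ J] [FiniteDimensional ℝ J]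

theorem lin1 (A : EJA J) (a b c y : J) :
    A.mul (A.mul a b) (A.mul c y) + A.mul (A.mul b c) (A.mul a y) + A.mul (A.mul a c) (A.mul b y)
    = A.mul a (A.mul (A.mul b c) y) + A.mul b (A.mul (A.mul a c) y)
      + A.mul c (A.mul (A.mul a b) y) := by
  have h1 := A.jordan (a + b + c) y
  have h2 := A.jordan (a + b) y
  have h3 := A.jordan (b + c) y
  have h4 := A.jordan (a + c) y
  have h5 := A.jordan a y
  have h6 := A.jordan b y
  have h7 := A.jordan c y
  simp only [map_add, LinearMap.add_apply, A.comm b a, A.comm c a, A.comm c b] at h1 h2 h3 h4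
  linear_combination (norm := module) (1/2 : ℝ) • (h1 - h2 - h3 - h4 + h5 + h6 + h7)

theorem lin2 (A : EJA J) (a b y w : J) :
    A.mul (A.mul a b) (A.mul y w) + A.mul (A.mul a y) (A.mul b w) + A.mul (A.mul b y) (A.mul a w)
    = A.mul a (A.mul y (A.mul b w)) + A.mul b (A.mul y (A.mul a w))
      + A.mul (A.mul (A.mul a b) y) w := by
  have h := A.lin1 a b w y
  rw [A.comm w y, A.comm (A.mul b w) (A.mul a y), A.comm (A.mul a w) (A.mul b y),
    A.comm (A.mul b w) y, A.comm (A.mul a w) y, A.comm w] at h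
  exact h

/-- even part of Peirce decomposition -/
theorem idem_comm (A : EJA J) {c p : J} (hc : A.mul c c = c)
    (hp : A.mul c (A.mul c p) = A.mul c p) (w : J) :
    A.mul c (A.mul p w) = A.mul p (A.mul c w) := by
  have h := A.lin1 c c p w
  have h' := A.lin1 c c (A.mul c p) w
  rw [hc] at h h'
  rw [hp] at h'
  linear_combination (norm := module) h - (2 : ℝ) • h'

theorem idem_cubic (A : EJA J) {c : J} (hc : A.mul c c = c) (w : J) :
    (2 : ℝ) • A.mul c (A.mul c (A.mul c w)) = (3 : ℝ) • A.mul c (A.mul c w) - A.mul c w := by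
  have h := A.lin2 c c c w
  simp only [hc] at h
  linear_combination (norm := module) -h

theorem half_half (A : EJA J) {c a b : J} (hc : A.mul c c = c)
    (ha : A.mul c a = (1/2 : ℝ) • a) (hb : A.mul c b = (1/2 : ℝ) • b) :
    A.mul c (A.mul c (A.mul a b)) = A.mul c (A.mul a b) := by
  have h := A.lin1 a b c c
  rw [A.comm b c, A.comm a c, ha, hb, hc] at h
  simp only [map_smul, LinearMap.smul_apply, A.comm b a, A.comm (A.mul a b) c, A.comm a c,
    A.comm b c, ha, hb] at h
  linear_combination (norm := module) -h

/-- Peirce reflection -/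
def refl (A : EJA J) (c x : J) : J := x - (8 : ℝ) • (A.mul c x - A.mul c (A.mul c x))

theorem refl_decomp (A : EJA J) {c : J} (hc : A.mul c c = c) (x : J) :
    ∃ p h, x = p + h ∧ A.mul c (A.mul c p) = A.mul c p ∧ A.mul c h = (1/2 : ℝ) • h := by
  have hq := A.idem_cubic hc x
  have hq2 := A.idem_cubic hc (A.mul c x)
  refine ⟨x - (4 : ℝ) • (A.mul c x - A.mul c (A.mul c x)),
    (4 : ℝ) • (A.mul c x - A.mul c (A.mul c x)), by abel, ?_, ?_⟩
  · simp only [map_sub, map_smul]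
    linear_combination (norm := module) (2 : ℝ) • hq2 - hq
  · simp only [map_sub, map_smul]
    linear_combination (norm := module) -(2 : ℝ) • hq

theorem refl_eq (A : EJA J) {c p h : J} 
    (hp : A.mul c (A.mul c p) = A.mul c p) (hh : A.mul c h = (1/2 : ℝ) • h) :
    A.refl c (p + h) = p - h := by
  simp only [refl, map_add, hp, hh, map_smul]
  module

theorem refl_mul (A : EJA J) {c : J} (hc : A.mul c c = c) (x y : J) :
    A.refl c (A.mul x y) = A.mul (A.refl c x) (A.refl c y) := by
  obtain ⟨p, h, rfl, hp, hh⟩ := A.refl_decomp hc x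
  obtain ⟨p', h', rfl, hp', hh'⟩ := A.refl_decomp hc y
  rw [A.refl_eq hp hh, A.refl_eq hp' hh']
  have e1 : A.mul (p + h) (p' + h') = (A.mul p p' + A.mul h h') + (A.mul p h' + A.mul p' h) := by
    simp only [map_add, LinearMap.add_apply, A.comm h p']; abel
  rw [e1, A.refl_eq]
  · simp only [map_sub, LinearMap.sub_apply, A.comm h p']; abel
  · simp only [map_add, A.half_half hc hh hh', A.idem_comm hc hp, hp']
  · simp only [map_add, A.idem_comm hc hp, A.idem_comm hc hp', hh, hh', map_smul, smul_add]

theorem refl_refl (A : EJA J) {c : J} (hc : A.mul c c = c) (x : J) :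
    A.refl c (A.refl c x) = x := by
  obtain ⟨p, h, rfl, hp, hh⟩ := A.refl_decomp hc x
  rw [A.refl_eq hp hh, sub_eq_add_neg, A.refl_eq hp (by simp [hh])]
  simp

theorem refl_prim (A : EJA J) {c d : J} (hc : A.mul c c = c) (hd : A.IsPrimitive d) :
    A.IsPrimitive (A.refl c d) := by
  obtain ⟨h1, h2, h3⟩ := hd
  have z0 : A.refl c 0 = 0 := by simp [refl]
  refine ⟨?_, ?_, ?_⟩
  · show A.mul _ _ = _
    rw [← A.refl_mul hc]; congr 1
  · intro h
    apply h2
    rw [← A.refl_refl hc d, h, z0]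
  · intro f hf hdf
    have := h3 (A.refl c f) (show A.mul _ _ = _ by rw [← A.refl_mul hc]; congr 1)
      (by nth_rewrite 1 [← A.refl_refl hc d]
          rw [← A.refl_mul hc]; congr 1)
    rcases this with h | h
    · left; rw [← A.refl_refl hc f, h, z0]
    · right; rw [← h, A.refl_refl hc]

theorem refl_tr (A : EJA J) {c : J} (hc : A.mul c c = c) (x : J) :
    A.tr (A.refl c x) = A.tr x := by
  obtain ⟨d, l, hd, rfl⟩ := A.spectral x
  have : A.refl c (∑ j, l j • d j) = ∑ j, l j • A.refl c (d j) := by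
    simp only [refl, map_sum, map_smul, ← Finset.sum_sub_distrib, Finset.smul_sum]
    refine Finset.sum_congr rfl fun j _ => ?_
    module
  rw [this]
  simp only [map_sum, map_smul]
  refine Finset.sum_congr rfl fun j _ => ?_
  rw [A.tr_prim _ (A.refl_prim hc (hd.1 j)), A.tr_prim _ (hd.1 j)]

theorem half_tr (A : EJA J) {c h : J} (hc : A.mul c c = c) (hh : A.mul c h = (1/2 : ℝ) • h) :
    A.tr h = 0 := by
  have h1 := A.refl_tr hc h
  have h2 := A.refl_eq (c := c) (p := 0) (h := h) (by simp) hh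
  rw [zero_add, zero_sub] at h2
  rw [h2, map_neg] at h1
  linarith

theorem tr_assoc_idem (A : EJA J) {c : J} (hc : A.mul c c = c) (x y : J) :
    A.tr (A.mul x (A.mul y c)) = A.tr (A.mul y (A.mul x c)) := by
  have h1 := A.lin2 c c y x
  have h2 := A.lin2 c c x y
  rw [← sub_eq_zero, ← map_sub]
  apply A.half_tr hc
  rw [hc, A.comm (A.mul c y) x, A.comm y x, A.comm c y,
    A.comm c x] at h1
  rw [hc, A.comm (A.mul c x) y, A.comm c x, A.comm c y, A.comm (A.mul x c) (A.mul y c)] at h2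
  rw [map_sub]
  linear_combination (norm := module) (1/2 : ℝ) • (h1 - h2)

theorem tr_assoc (A : EJA J) (x y z : J) :
    A.tr (A.mul x (A.mul y z)) = A.tr (A.mul y (A.mul x z)) := by
  obtain ⟨d, l, hd, rfl⟩ := A.spectral z
  simp only [map_sum, map_smul]
  refine Finset.sum_congr rfl fun j _ => ?_
  rw [A.tr_assoc_idem (hd.1 j).1]

theorem tr_sq_nonneg (A : EJA J) (x : J) : 0 ≤ A.tr (A.mul x x) := by
  by_cases h : x = 0
  · simp [h]
  · exact (A.tr_posdef x h).le

theorem eq_zero_of_tr_sq (A : EJA J) {x : J} (h : A.tr (A.mul x x) ≤ 0) : x = 0 := by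
  by_contra h'
  exact absurd (A.tr_posdef x h') (not_lt.2 h)

theorem tr_idem_form (A : EJA J) {c : J} (hc : A.mul c c = c) (y : J) :
    A.tr (A.mul c (A.mul y y)) = A.tr (A.mul (A.mul c y) (A.mul c y)) +
      4 * A.tr (A.mul (A.mul c y - A.mul c (A.mul c y)) (A.mul c y - A.mul c (A.mul c y))) := by
  have hq := A.idem_cubic hc y
  have hq2 := A.idem_cubic hc (A.mul c y)
  have sa : ∀ u v, A.tr (A.mul (A.mul c u) v) = A.tr (A.mul u (A.mul c v)) := by
    intro u v
    rw [A.comm, A.tr_assoc v c u, A.comm v u, A.tr_assoc c u v]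
  rw [A.tr_assoc c y y]
  have key : A.mul c y = A.mul c (A.mul c y) + (4 : ℝ) • (A.mul c (A.mul c y)
      - (2 : ℝ) • A.mul c (A.mul c (A.mul c y)) + A.mul c (A.mul c (A.mul c (A.mul c y)))) := by
    linear_combination (norm := module) hq - (2 : ℝ) • hq2
  nth_rewrite 1 [key]
  simp only [map_add, map_sub, map_smul, LinearMap.sub_apply, sa, smul_eq_mul]
  ring

/-- the squares -/
def K (A : EJA J) : Set J := {x : J | ∃ y : J, x = A.mul y y}

theorem tr_idem_K (A : EJA J) {c x : J} (hc : A.mul c c = c) (hx : x ∈ A.K) :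
    0 ≤ A.tr (A.mul c x) := by
  obtain ⟨y, rfl⟩ := hx
  rw [A.tr_idem_form hc]
  have := A.tr_sq_nonneg (A.mul c y)
  have := A.tr_sq_nonneg (A.mul c y - A.mul c (A.mul c y))
  positivity

theorem mul_eq_zero_of_tr (A : EJA J) {c x : J} (hc : A.mul c c = c) (hx : x ∈ A.K)
    (h : A.tr (A.mul c x) ≤ 0) : A.mul c x = 0 := by
  obtain ⟨y, rfl⟩ := hx
  rw [A.tr_idem_form hc] at h
  have h2 := A.tr_sq_nonneg (A.mul c y - A.mul c (A.mul c y))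
  have h3 : A.mul c y = 0 := A.eq_zero_of_tr_sq (by linarith)
  rw [A.idem_comm hc (by rw [h3]; simp), h3]; simp

/-- frame combos -/
def F (A : EJA J) (c : Fin A.rank → J) (l : Fin A.rank → ℝ) : J := ∑ j, l j • c j

section frame
variable (A : EJA J) {c : Fin A.rank → J}

theorem F_add (l m : Fin A.rank → ℝ) : A.F c l + A.F c m = A.F c (l + m) := by
  simp [F, add_smul, Finset.sum_add_distrib]

theorem F_sub (l m : Fin A.rank → ℝ) : A.F c l - A.F c m = A.F c (l - m) := by
  simp [F, sub_smul, Finset.sum_sub_distrib]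

theorem F_smul (t : ℝ) (l : Fin A.rank → ℝ) : t • A.F c l = A.F c (t • l) := by
  simp [F, Finset.smul_sum, smul_smul]

theorem F_single (i : Fin A.rank) : A.F c (Pi.single i 1) = c i := by
  simp [F, Pi.single_apply, ite_smul]

theorem F_one (hc : A.IsFrame c) : A.F c 1 = A.e := by
  simpa [F] using hc.2.2

theorem F_mul (hc : A.IsFrame c) (l m : Fin A.rank → ℝ) : A.mul (A.F c l) (A.F c m) = A.F c (l * m) := by
  simp only [F, map_sum, LinearMap.sum_apply, map_smul, LinearMap.smul_apply, Finset.smul_sum]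
  refine Finset.sum_congr rfl fun j _ => ?_
  rw [Finset.sum_eq_single j]
  · rw [show A.mul (c j) (c j) = c j from (hc.1 j).1]
    simp [smul_smul, mul_comm]
  · intro i _ hij
    simp [hc.2.1 i j hij]
  · simp

theorem F_tr (hc : A.IsFrame c) (l : Fin A.rank → ℝ) : A.tr (A.F c l) = ∑ j, l j := by
  simp only [F, map_sum, map_smul]
  refine Finset.sum_congr rfl fun j _ => ?_
  rw [A.tr_prim _ (hc.1 j)]; simp

theorem F_tr_coord (hc : A.IsFrame c) (l : Fin A.rank → ℝ) (i : Fin A.rank) :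
    A.tr (A.mul (c i) (A.F c l)) = l i := by
  rw [← A.F_single (c := c) i, A.F_mul hc, A.F_tr hc]
  simp [Pi.single_apply]

theorem F_inj (hc : A.IsFrame c) {l m : Fin A.rank → ℝ} (h : A.F c l = A.F c m) : l = m := by
  funext i
  rw [← A.F_tr_coord hc l, h, A.F_tr_coord hc]

theorem F_comm (hc : A.IsFrame c) (l m : Fin A.rank → ℝ) (w : J) :
    A.mul (A.F c l) (A.mul (A.F c m) w) = A.mul (A.F c m) (A.mul (A.F c l) w) := by
  simp only [F, map_sum, LinearMap.sum_apply, map_smul, LinearMap.smul_apply, Finset.smul_sum]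
  rw [Finset.sum_comm]
  refine Finset.sum_congr rfl fun i _ => Finset.sum_congr rfl fun j _ => ?_
  rw [smul_comm]
  by_cases h : i = j
  · rw [h]
  · rw [A.idem_comm (hc.1 j).1]
    simp [hc.2.1 j i (Ne.symm h)]

theorem F_mem_K (hc : A.IsFrame c) {l : Fin A.rank → ℝ} : A.F c l ∈ A.K ↔ ∀ j, 0 ≤ l j := by
  constructor
  · intro h j
    have := A.tr_idem_K (hc.1 j).1 h
    rwa [A.F_tr_coord hc] at this
  · intro h
    refine ⟨A.F c fun j => Real.sqrt (l j), ?_⟩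
    rw [A.F_mul hc]
    congr 1
    funext j
    simp [Real.mul_self_sqrt (h j)]

end frame

theorem exists_F (A : EJA J) (x : J) : ∃ (c : Fin A.rank → J) (l : Fin A.rank → ℝ),
    A.IsFrame c ∧ x = A.F c l := A.spectral x

theorem mem_K_iff (A : EJA J) (x : J) :
    x ∈ A.K ↔ ∀ c, A.mul c c = c → 0 ≤ A.tr (A.mul c x) := by
  constructor
  · intro h c hc
    exact A.tr_idem_K hc h
  · intro h
    obtain ⟨c, l, hc, rfl⟩ := A.exists_F x
    rw [A.F_mem_K hc]
    intro j
    rw [← A.F_tr_coord hc l j]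
    exact h _ (hc.1 j).1

theorem K_add (A : EJA J) {x y : J} (hx : x ∈ A.K) (hy : y ∈ A.K) : x + y ∈ A.K := by
  rw [mem_K_iff] at *
  intro c hc
  rw [map_add, map_add]
  exact add_nonneg (hx c hc) (hy c hc)

theorem K_smul (A : EJA J) {x : J} {t : ℝ} (ht : 0 ≤ t) (hx : x ∈ A.K) : t • x ∈ A.K := by
  rw [mem_K_iff] at *
  intro c hc
  rw [map_smul, map_smul]
  exact mul_nonneg ht (hx c hc)

theorem K_zero (A : EJA J) : (0 : J) ∈ A.K := ⟨0, by simp⟩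

theorem K_sum (A : EJA J) {ι : Type} (s : Finset ι) (f : ι → J) (h : ∀ i ∈ s, f i ∈ A.K) :
    ∑ i ∈ s, f i ∈ A.K := by
  rw [mem_K_iff]
  intro c hc
  rw [map_sum, map_sum]
  exact Finset.sum_nonneg fun i hi => A.tr_idem_K hc (h i hi)

theorem idem_compl (A : EJA J) {c : J} (hc : A.mul c c = c) :
    A.mul (A.e - c) (A.e - c) = A.e - c := by
  simp only [map_sub, LinearMap.sub_apply, A.unit_mul, hc, A.comm c A.e]
  abel

theorem compl_mul (A : EJA J) (c u : J) : A.mul (A.e - c) u = u - A.mul c u := by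
  simp [A.unit_mul]

/-- idempotents in a decomposition of an element of the Peirce one-space -/
theorem supp_le (A : EJA J) {c u : J} (hc : A.mul c c = c) (hu : A.mul c u = u)
    {d : Fin A.rank → J} (hd : A.IsFrame d) {m : Fin A.rank → ℝ} (h : u = A.F d m)
    (j : Fin A.rank) (hj : m j ≠ 0) : A.mul c (d j) = d j := by
  have hf := A.idem_compl hc
  have hd' : ∀ i, d i ∈ A.K := fun i => ⟨d i, (hd.1 i).1.symm⟩
  have h0 : A.tr (A.mul (A.e - c) (A.mul u u)) = 0 := by
    rw [A.tr_assoc, A.compl_mul, hu]; simp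
  have h1 : ∑ i, m i * m i * A.tr (A.mul (A.e - c) (d i)) = 0 := by
    rw [← h0, h, A.F_mul hd]
    simp only [F, map_sum, map_smul]
    rfl
  have hn : ∀ i ∈ Finset.univ, 0 ≤ m i * m i * A.tr (A.mul (A.e - c) (d i)) := fun i _ =>
    mul_nonneg (mul_self_nonneg _) (A.tr_idem_K hf (hd' i))
  have h2 := (Finset.sum_eq_zero_iff_of_nonneg hn).1 h1 j (Finset.mem_univ _)
  have h3 : A.tr (A.mul (A.e - c) (d j)) = 0 := by
    rcases mul_eq_zero.1 h2 with h | h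
    · exact absurd (mul_self_eq_zero.1 h) hj
    · exact h
  have h4 := A.mul_eq_zero_of_tr hf (hd' j) h3.le
  rw [A.compl_mul] at h4
  exact (sub_eq_zero.1 h4).symm

end EJA

namespace EJA

variable {J : Type} [NormedAddCommGroup J] [NormedSpace ℝ J] [FiniteDimensional ℝ J]

/-- indicator of the support -/
noncomputable def ind {n : ℕ} (l : Fin n → ℝ) : Fin n → ℝ := fun j => if l j ≠ 0 then 1 else 0

theorem ind_mul {n : ℕ} (l : Fin n → ℝ) : ind l * l = l := by
  funext j
  by_cases h : l j = 0 <;> simp [ind, h]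

theorem ind_ind {n : ℕ} (l : Fin n → ℝ) : ind l * ind l = ind l := by
  funext j
  by_cases h : l j = 0 <;> simp [ind, h]

theorem ind_sum {n : ℕ} (l : Fin n → ℝ) :
    ∑ j, ind l j = ((Finset.univ.filter fun j => l j ≠ 0).card : ℝ) := by
  simp only [ind, Finset.sum_boole]

theorem tr_idem_nonneg (A : EJA J) {c : J} (hc : A.mul c c = c) : 0 ≤ A.tr c := by
  have := A.tr_sq_nonneg c
  rwa [hc] at this

theorem supp_mul (A : EJA J) {c u : J} (hc : A.mul c c = c) (hu : A.mul c u = u)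
    {d : Fin A.rank → J} (hd : A.IsFrame d) {m : Fin A.rank → ℝ} (h : u = A.F d m) :
    A.mul c (A.F d (ind m)) = A.F d (ind m) := by
  simp only [F, map_sum, map_smul]
  refine Finset.sum_congr rfl fun j _ => ?_
  by_cases hj : m j = 0
  · simp [ind, hj]
  · rw [A.supp_le hc hu hd h j hj]

theorem sub_idem (A : EJA J) {c s : J} (hc : A.mul c c = c) (hs : A.mul s s = s)
    (h : A.mul c s = s) : A.mul (c - s) (c - s) = c - s := by
  simp only [map_sub, LinearMap.sub_apply, hc, hs, A.comm s c, h]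
  abel

theorem rank_le (A : EJA J) {c u : J} (hc : A.mul c c = c) (hu : A.mul c u = u)
    {k : ℕ} (h : A.HasRank u k) : (k : ℝ) ≤ A.tr c := by
  obtain ⟨d, m, hd, h1, h2⟩ := h
  have hs := A.supp_mul hc hu hd h1
  have := A.tr_idem_nonneg (A.sub_idem hc (s := A.F d (ind m))
    (by rw [A.F_mul hd, ind_ind]) hs)
  rw [map_sub, A.F_tr hd, ind_sum, h2] at this
  linarith

theorem rank_supp (A : EJA J) {u : J} {k : ℕ} (h : A.HasRank u k) :
    ∃ c, A.mul c c = c ∧ A.mul c u = u ∧ A.tr c = k := by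
  obtain ⟨d, m, hd, h1, h2⟩ := h
  refine ⟨A.F d (ind m), by rw [A.F_mul hd, ind_ind], ?_, ?_⟩
  · rw [h1]; change A.mul _ (A.F d m) = A.F d m
    rw [A.F_mul hd, ind_mul]
  · rw [A.F_tr hd, ind_sum, h2]

theorem rank_exists (A : EJA J) (u : J) : ∃ k, A.HasRank u k := by
  obtain ⟨c, l, hc, h⟩ := A.spectral u
  exact ⟨_, c, l, hc, h, rfl⟩

theorem rank_unique (A : EJA J) {u : J} {k m : ℕ} (h : A.HasRank u k) (h' : A.HasRank u m) :
    k ≤ m := by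
  obtain ⟨c, hc, hu, ht⟩ := A.rank_supp h'
  have := A.rank_le hc hu h
  rw [ht] at this
  exact_mod_cast this

theorem rank_iff_of_le (A : EJA J) {u v : J}
    (h1 : ∀ k m, A.HasRank u k → A.HasRank v m → k ≤ m)
    (h2 : ∀ k m, A.HasRank v k → A.HasRank u m → k ≤ m) (k : ℕ) :
    A.HasRank u k ↔ A.HasRank v k := by
  obtain ⟨a, ha⟩ := A.rank_exists u
  obtain ⟨b, hb⟩ := A.rank_exists v
  have hab : a = b := le_antisymm (h1 _ _ ha hb) (h2 _ _ hb ha)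
  subst hab
  constructor
  · intro h
    rwa [le_antisymm (A.rank_unique h ha) (A.rank_unique ha h)]
  · intro h
    rwa [le_antisymm (A.rank_unique h hb) (A.rank_unique hb h)]

/-- order lemma: elements dominated by `a` live in the Peirce space of the support of `a` -/
theorem dominated (A : EJA J) {c a b : J} (hc : A.mul c c = c) (ha : A.mul c a = a)
    (hb : b ∈ A.K) (hab : a - b ∈ A.K) : A.mul c b = b := by
  have hf := A.idem_compl hc
  have h1 := A.tr_idem_K hf hab
  rw [map_sub, A.compl_mul c a, ha, sub_self, zero_sub, map_neg] at h1
  have h2 := A.mul_eq_zero_of_tr hf hb (by linarith)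
  rw [A.compl_mul] at h2
  exact (sub_eq_zero.1 h2).symm

theorem chain (A : EJA J) {a b : J} (ha : a ∈ A.K) (hb : b ∈ A.K) (hab : a - b ∈ A.K)
    {m n : ℕ} (hm : A.HasRank a m) (hn : A.HasRank b n) (hmn : m ≤ n) :
    ∃ C : ℝ, C • b - a ∈ A.K := by
  obtain ⟨d, α, hd, h1, h2⟩ := hm
  obtain ⟨f, β, hf, h3, h4⟩ := hn
  change a = A.F d α at h1
  change b = A.F f β at h3
  have hs1 : A.mul (A.F d (ind α)) (A.F d (ind α)) = A.F d (ind α) := by rw [A.F_mul hd, ind_ind]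
  have hs2 : A.mul (A.F f (ind β)) (A.F f (ind β)) = A.F f (ind β) := by rw [A.F_mul hf, ind_ind]
  have ha1 : A.mul (A.F d (ind α)) a = a := by rw [h1, A.F_mul hd, ind_mul]
  have hb1 := A.dominated hs1 ha1 hb hab
  have hs := A.supp_mul hs1 hb1 hf h3
  have hi := A.sub_idem hs1 hs2 hs
  have heq : A.F d (ind α) - A.F f (ind β) = 0 := by
    apply A.eq_zero_of_tr_sq
    rw [hi, map_sub, A.F_tr hd, A.F_tr hf, ind_sum, ind_sum, h2, h4]
    have : (m : ℝ) ≤ n := by exact_mod_cast hmn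
    linarith
  rw [h1, A.F_mem_K hd] at ha
  rw [h3, A.F_mem_K hf] at hb
  have hM : (∑ j, α j) • A.F d (ind α) - a ∈ A.K := by
    rw [h1, A.F_smul, A.F_sub, A.F_mem_K hd]
    intro j
    have := Finset.single_le_sum (fun i _ => ha i) (Finset.mem_univ j)
    by_cases h : α j = 0 <;> simp [ind, h, this]
  have hN : (∑ j, (β j)⁻¹) • b - A.F f (ind β) ∈ A.K := by
    rw [h3, A.F_smul, A.F_sub, A.F_mem_K hf]
    intro j
    have := Finset.single_le_sum (fun i _ => inv_nonneg.2 (hb i)) (Finset.mem_univ j)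
    by_cases h : β j = 0
    · simp [ind, h]
    · have h5 := mul_le_mul_of_nonneg_right this (hb j)
      rw [inv_mul_cancel₀ h] at h5
      simpa [ind, h] using h5
  refine ⟨(∑ j, α j) * (∑ j, (β j)⁻¹), ?_⟩
  have := A.K_add (A.K_smul (Finset.sum_nonneg fun i (_ : i ∈ Finset.univ) => ha i) hN) hM
  rw [sub_eq_zero.1 heq] at this
  convert this using 1
  module

theorem rank_pos (A : EJA J) (g : J ≃ₗ[ℝ] J) (h1 : ∀ x ∈ A.K, g x ∈ A.K)
    (h2 : ∀ x ∈ A.K, g.symm x ∈ A.K) (k : ℕ) : ∀ a ∈ A.K, ∀ m, A.HasRank a k →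
    A.HasRank (g a) m → k ≤ m := by
  induction k with
  | zero => intros; exact Nat.zero_le _
  | succ k ih =>
    intro a ha m hk hm
    obtain ⟨c, l, hc, e1, e2⟩ := hk
    change a = A.F c l at e1
    have hne : (Finset.univ.filter fun j => l j ≠ 0).Nonempty := by
      rw [← Finset.card_pos, e2]; omega
    obtain ⟨i, hi⟩ := hne
    have hl : ∀ j, 0 ≤ l j := by rwa [e1, A.F_mem_K hc] at ha
    have hli : l i ≠ 0 := by simpa using hi
    set l' := Function.update l i 0 with hl'
    have hb : A.F c l' ∈ A.K := by
      rw [A.F_mem_K hc]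
      intro j
      by_cases h : j = i
      · subst h; simp [hl']
      · simp [hl', h, hl]
    have hab : a - A.F c l' ∈ A.K := by
      rw [e1, A.F_sub, A.F_mem_K hc]
      intro j
      by_cases h : j = i
      · subst h; simp [hl', hl]
      · simp [hl', h]
    have hbk : A.HasRank (A.F c l') k := by
      refine ⟨c, l', hc, rfl, ?_⟩
      have : (Finset.univ.filter fun j => l' j ≠ 0)
          = (Finset.univ.filter fun j => l j ≠ 0).erase i := by
        ext j
        by_cases h : j = i
        · subst h; simp [hl']
        · simp [hl', h]
      rw [this, Finset.card_erase_of_mem hi, e2]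
      rfl
    obtain ⟨n, hn⟩ := A.rank_exists (g (A.F c l'))
    have hkn := ih _ hb n hbk hn
    by_contra hlt
    obtain ⟨C, hC⟩ := A.chain (h1 _ ha) (h1 _ hb) (by rw [← map_sub]; exact h1 _ hab) hm hn
      (by omega)
    have h3 := h2 _ hC
    rw [← map_smul, ← map_sub, LinearEquiv.symm_apply_apply, e1, A.F_smul, A.F_sub,
      A.F_mem_K hc] at h3
    have h4 := h3 i
    simp [hl'] at h4
    exact hli (le_antisymm h4 (hl i))

theorem rank_map_le (A : EJA J) (g : J ≃ₗ[ℝ] J) (h1 : ∀ x ∈ A.K, g x ∈ A.K)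
    (h2 : ∀ x ∈ A.K, g.symm x ∈ A.K) (u : J) (k m : ℕ) (hk : A.HasRank u k)
    (hm : A.HasRank (g u) m) : m ≤ k := by
  obtain ⟨c, l, hc, e1, e2⟩ := hk
  change u = A.F c l at e1
  have ha : A.F c (fun j => |l j|) ∈ A.K := by
    rw [A.F_mem_K hc]; intro j; positivity
  have hak : A.HasRank (A.F c (fun j => |l j|)) k := ⟨c, _, hc, rfl, by simpa using e2⟩
  set a := A.F c (fun j => |l j|) with hadef
  have hp : a + u ∈ A.K := by
    rw [e1, hadef, A.F_add, A.F_mem_K hc]; intro j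
    have := neg_abs_le (l j)
    simp only [Pi.add_apply]; linarith
  have hq : a - u ∈ A.K := by
    rw [e1, hadef, A.F_sub, A.F_mem_K hc]; intro j
    have := le_abs_self (l j)
    simp only [Pi.sub_apply]; linarith
  obtain ⟨n, hn⟩ := A.rank_exists (g a)
  have hnk : n ≤ k := A.rank_pos g.symm h2 (by simpa using h1) n (g a) (h1 _ ha) k hn
    (by simpa using hak)
  obtain ⟨s, hs, hsa, hst⟩ := A.rank_supp hn
  have h2a : A.mul s ((2 : ℝ) • g a) = (2 : ℝ) • g a := by rw [map_smul, hsa]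
  have h3 := A.dominated hs h2a (h1 _ hp) (by
    have := h1 _ hq
    rw [map_sub] at this
    rw [map_add]
    convert this using 1
    module)
  have h4 : A.mul s (g u) = g u := by
    rw [map_add, map_add, hsa] at h3
    exact add_left_cancel h3
  have := A.rank_le hs h4 hm
  rw [hst] at this
  have : m ≤ n := by exact_mod_cast this
  omega

theorem rank_map (A : EJA J) (g : J ≃ₗ[ℝ] J) (h1 : ∀ x ∈ A.K, g x ∈ A.K)
    (h2 : ∀ x ∈ A.K, g.symm x ∈ A.K) (u : J) (k : ℕ) :
    A.HasRank (g u) k ↔ A.HasRank u k := by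
  apply A.rank_iff_of_le
  · intro k m hk hm
    exact A.rank_map_le g h1 h2 u m k hm hk
  · intro k m hk hm
    exact A.rank_map_le g.symm h2 (by simpa using h1) (g u) m k hm (by simpa using hk)

/-- quadratic representation -/
def P (A : EJA J) (y : J) : J →ₗ[ℝ] J :=
  (2 : ℝ) • (A.mul y ∘ₗ A.mul y) - A.mul (A.mul y y)

theorem P_apply (A : EJA J) (y w : J) :
    A.P y w = (2 : ℝ) • A.mul y (A.mul y w) - A.mul (A.mul y y) w := by
  simp [P]

theorem prim_one (A : EJA J) {c u : J} (hc : A.IsPrimitive c) (hu : A.mul c u = u) :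
    ∃ a : ℝ, u = a • c := by
  obtain ⟨d, m, hd, h⟩ := A.exists_F u
  refine ⟨∑ j, m j, ?_⟩
  rw [Finset.sum_smul]
  nth_rewrite 1 [h]
  unfold F
  refine Finset.sum_congr rfl fun j _ => ?_
  by_cases hj : m j = 0
  · simp [hj]
  · have h1 := A.supp_le hc.1 hu hd h j hj
    rcases hc.2.2 _ (hd.1 j).1 h1 with h2 | h2
    · exact absurd h2 (hd.1 j).2.1
    · rw [h2]

theorem P_prim (A : EJA J) (y : J) {c : J} (hp : A.IsPrimitive c) : A.P y c ∈ A.K := by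
  have hc : A.mul c c = c := hp.1
  have hq := A.idem_cubic hc y
  have hq2 := A.idem_cubic hc (A.mul c y)
  obtain ⟨a, ha⟩ := A.prim_one hp (u := (2 : ℝ) • A.mul c (A.mul c y) - A.mul c y) (by
    simp only [map_sub, map_smul]
    linear_combination (norm := module) hq)
  obtain ⟨h, hh⟩ : ∃ h, h = (4 : ℝ) • (A.mul c y - A.mul c (A.mul c y)) := ⟨_, rfl⟩
  obtain ⟨z, hz⟩ : ∃ z, z = y - (3 : ℝ) • A.mul c y + (2 : ℝ) • A.mul c (A.mul c y) := ⟨_, rfl⟩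
  have hy : y = a • c + h + z := by
    rw [hh, hz, ← ha]; module
  have hch : A.mul c h = (1/2 : ℝ) • h := by
    rw [hh]; simp only [map_sub, map_smul]
    linear_combination (norm := module) -(2 : ℝ) • hq
  have hcz : A.mul c z = 0 := by
    rw [hz]; simp only [map_sub, map_add, map_smul]
    linear_combination (norm := module) hq
  obtain ⟨n, hn⟩ := A.prim_one hp (A.half_half hc hch hch)
  obtain ⟨q, hqd⟩ : ∃ q, q = A.mul h h - n • c := ⟨_, rfl⟩
  have hhq : A.mul h h = n • c + q := by rw [hqd]; module
  have hcq : A.mul c q = 0 := by rw [hqd, map_sub, map_smul, hn, hc]; simp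
  have hhqh : A.mul h q = (n/2) • h := by
    have j := A.jordan h c
    rw [A.comm (A.mul h h) c, A.comm h c, hch, hn, map_smul, map_smul, A.comm _ h, A.comm h c,
      hch, hhq] at j
    simp only [map_add, map_smul, A.comm h c, hch] at j
    linear_combination (norm := module) (2 : ℝ) • j
  have hqq : A.mul q q = n • q := by
    have j := A.jordan h h
    rw [A.comm (A.mul h h) h] at j
    rw [hhq] at j
    simp only [map_add, map_smul, LinearMap.add_apply, LinearMap.smul_apply, A.comm h c, hch,
      A.comm q c, hcq, hc, hhqh, hhq] at j
    linear_combination (norm := module) j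
  have hcc : A.mul c (A.mul z z) = 0 := by
    rw [A.idem_comm hc (by rw [hcz]; simp), hcz]; simp
  have hczh : A.mul c (A.mul z h) = (1/2 : ℝ) • A.mul z h := by
    rw [A.idem_comm hc (by rw [hcz]; simp), hch]; simp
  have hv : A.P y c = (a^2) • c + a • h + q := by
    rw [P_apply, A.comm (A.mul y y) c, A.comm y c, hy]
    simp only [map_add, map_smul, LinearMap.add_apply, LinearMap.smul_apply, hc, hch, hcz,
      A.comm h c, A.comm z c, A.comm h z, hcc, hczh, hhq, hcq, map_zero]
    module
  have hvv : A.mul (A.P y c) (A.P y c) = (a^2 + n) • A.P y c := by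
    rw [hv]
    simp only [map_add, map_smul, LinearMap.add_apply, LinearMap.smul_apply, hc, hch, hcq,
      A.comm h c, A.comm q c, A.comm q h, hhqh, hqq, hhq]
    module
  have hn0 : 0 ≤ n := by
    have := A.tr_idem_K hc (x := A.mul h h) ⟨h, rfl⟩
    rw [hn, map_smul, A.tr_prim c hp] at this
    simpa using this
  by_cases h0 : a^2 + n = 0
  · rw [h0, zero_smul] at hvv
    rw [A.eq_zero_of_tr_sq (x := A.P y c) (by rw [hvv]; simp)]
    exact A.K_zero
  · have h1 : A.P y c = (a^2 + n)⁻¹ • A.mul (A.P y c) (A.P y c) := by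
      rw [hvv, smul_smul, inv_mul_cancel₀ h0, one_smul]
    rw [h1]
    exact A.K_smul (by positivity) ⟨_, rfl⟩

theorem P_K (A : EJA J) (y x : J) (hx : x ∈ A.K) : A.P y x ∈ A.K := by
  obtain ⟨c, l, hc, rfl⟩ := A.exists_F x
  rw [A.F_mem_K hc] at hx
  simp only [F, map_sum, map_smul]
  exact A.K_sum _ _ fun i _ => A.K_smul (hx i) (A.P_prim y (hc.1 i))

/-- frame form of inverse -/
def Inv (A : EJA J) (x xi : J) : Prop := ∃ c l m, A.IsFrame c ∧ x = A.F c l ∧ xi = A.F c m ∧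
  l * m = 1

theorem Inv.symm {A : EJA J} {x xi : J} (h : A.Inv x xi) : A.Inv xi x := by
  obtain ⟨c, l, m, hc, h1, h2, h3⟩ := h
  exact ⟨c, m, l, hc, h2, h1, by rwa [mul_comm]⟩

theorem IsInverse.inv {A : EJA J} {x xi : J} (h : A.IsInverse x xi) : A.Inv x xi := by
  obtain ⟨h1, h2⟩ := h
  obtain ⟨c, l, hc, hx⟩ := A.exists_F x
  have hpow : ∀ n, A.pow x n = A.F c (l ^ n) := by
    intro n
    induction n with
    | zero => rw [pow_zero, A.F_one hc]; rfl
    | succ n ih =>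
      show A.mul x (A.pow x n) = _
      rw [ih, hx, A.F_mul hc, pow_succ']
  have : ∃ m, xi = A.F c m := by
    clear h2
    induction h1 using Submodule.span_induction with
    | mem y hy => obtain ⟨n, rfl⟩ := hy; exact ⟨_, hpow n⟩
    | zero => exact ⟨0, by simp [F]⟩
    | add y z _ _ hy hz =>
      obtain ⟨a, rfl⟩ := hy
      obtain ⟨b, rfl⟩ := hz
      exact ⟨_, A.F_add _ _⟩
    | smul t y _ hy =>
      obtain ⟨a, rfl⟩ := hy
      exact ⟨_, A.F_smul _ _⟩
  obtain ⟨m, hm⟩ := this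
  refine ⟨c, l, m, hc, hx, hm, ?_⟩
  rw [hx, hm, A.F_mul hc, ← A.F_one hc] at h2
  exact A.F_inj hc h2

theorem P_inv (A : EJA J) {x xi : J} (h : A.Inv x xi) (w : J) : A.P x (A.P xi w) = w := by
  obtain ⟨c, l, m, hc, h1, h2, h3⟩ := h
  have hm1 : A.mul x xi = A.e := by rw [h1, h2, A.F_mul hc, h3, A.F_one hc]
  have hm2 : A.mul (A.mul x x) xi = x := by
    rw [h1, h2, A.F_mul hc, A.F_mul hc, mul_assoc, h3, mul_one]
  have hm3 : A.mul (A.mul x x) (A.mul xi xi) = A.e := by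
    rw [h1, h2, A.F_mul hc, A.F_mul hc, A.F_mul hc, mul_mul_mul_comm, h3, mul_one, A.F_one hc]
  have hm4 : A.mul x (A.mul xi xi) = xi := by
    rw [h1, h2, A.F_mul hc, A.F_mul hc, ← mul_assoc, h3, one_mul]
  have c1 : ∀ w, A.mul xi (A.mul x w) = A.mul x (A.mul xi w) := by
    intro w; rw [h1, h2, A.F_comm hc]
  have c2 : ∀ w, A.mul (A.mul xi xi) (A.mul x w) = A.mul x (A.mul (A.mul xi xi) w) := by
    intro w; rw [h1, h2, A.F_mul hc, A.F_comm hc]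
  have k1 : ∀ w, A.P x (A.mul xi w) = A.mul x w := by
    intro w
    have := A.lin2 x x xi w
    rw [hm1, hm2, A.unit_mul, c1] at this
    rw [P_apply]
    linear_combination (norm := module) -this
  have k2 : A.P x (A.mul (A.mul xi xi) w) = (2 : ℝ) • A.mul xi (A.mul x w) - w := by
    have := A.lin2 x x (A.mul xi xi) w
    rw [hm3, hm4, A.unit_mul, c2] at this
    rw [P_apply]
    linear_combination (norm := module) -this
  rw [A.P_apply xi, map_sub, map_smul, k1, k2, c1]
  module

theorem P_mem (A : EJA J) {c z : J} (hc : A.mul c c = c) (hz : A.mul c z = z) (w : J) :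
    A.mul c (A.P z w) = A.P z w := by
  have c1 := A.idem_comm hc (p := z) (by rw [hz, hz])
  have hzz : A.mul c (A.mul z z) = A.mul z z := by rw [c1, hz]
  have c2 := A.idem_comm hc (p := A.mul z z) (by rw [hzz, hzz])
  have := A.lin2 z z c w
  rw [A.comm z c, hz, A.comm (A.mul z z) c, hzz, c1, ← c2] at this
  rw [P_apply, map_sub, map_smul, c1, c1]
  linear_combination (norm := module) -this

theorem P_diff (A : EJA J) {x y xi yi : J} (hx : A.Inv x xi) (hy : A.Inv y yi) :
    A.P y (xi - yi) = (y - x) + A.P (y - x) xi := by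
  have hyy : A.P y yi = y := by
    obtain ⟨c, l, m, hc, h1, h2, h3⟩ := hy
    rw [P_apply, h1, h2, A.F_mul hc, A.F_mul hc, A.F_mul hc, A.F_mul hc, mul_assoc, h3, mul_one]
    module
  obtain ⟨c, l, m, hc, h1, h2, h3⟩ := hx
  have hm1 : A.mul x xi = A.e := by rw [h1, h2, A.F_mul hc, h3, A.F_one hc]
  have hm2 : A.mul (A.mul x x) xi = x := by
    rw [h1, h2, A.F_mul hc, A.F_mul hc, mul_assoc, h3, mul_one]
  have c1 : A.mul xi (A.mul x y) = A.mul x (A.mul xi y) := by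
    rw [h1, h2, A.F_comm hc]
  have hxe : A.mul x A.e = x := by rw [A.comm, A.unit_mul]
  have hye : A.mul y A.e = y := by rw [A.comm, A.unit_mul]
  rw [map_sub, hyy, P_apply, P_apply]
  simp only [map_sub, LinearMap.sub_apply, hm1, hm2, A.comm y x, hxe, hye,
    A.comm (A.mul x y) xi, c1, A.comm xi y]
  module

/-- `P y` as a linear equivalence -/
noncomputable def Pequiv (A : EJA J) {y yi : J} (h : A.Inv y yi) : J ≃ₗ[ℝ] J :=
  LinearEquiv.ofLinearMap (A.P y) (A.P yi)
    (LinearMap.ext fun w => A.P_inv h w) (LinearMap.ext fun w => A.P_inv h.symm w)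

theorem rank_inv_le (A : EJA J) {x y xi yi : J} (hx : A.Inv x xi) (hy : A.Inv y yi)
    (k m : ℕ) (hk : A.HasRank (xi - yi) k) (hm : A.HasRank (x - y) m) : k ≤ m := by
  obtain ⟨s, hs, hsx, hst⟩ := A.rank_supp hm
  have hz : A.mul s (y - x) = y - x := by
    rw [← neg_sub x y, map_neg, hsx]
  have h1 : A.mul s (A.P y (xi - yi)) = A.P y (xi - yi) := by
    rw [A.P_diff hx hy, map_add, hz, A.P_mem hs hz]
  have h2 : A.HasRank (A.P y (xi - yi)) k :=
    (A.rank_map (A.Pequiv hy) (A.P_K y) (A.P_K yi) (xi - yi) k).2 hk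
  have := A.rank_le hs h1 h2
  rw [hst] at this
  exact_mod_cast this

theorem HasRank.neg {A : EJA J} {u : J} {k : ℕ} (h : A.HasRank u k) : A.HasRank (-u) k := by
  obtain ⟨c, l, hc, h1, h2⟩ := h
  refine ⟨c, -l, hc, ?_, by simpa using h2⟩
  rw [h1]; simp

theorem K_closed (A : EJA J) : IsClosed A.K := by
  have : A.K = ⋂ c : {c : J // A.mul c c = c}, {x | 0 ≤ (A.tr ∘ₗ A.mul c.1) x} := by
    ext x
    rw [mem_K_iff]
    simp
  rw [this]
  refine isClosed_iInter fun c => ?_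
  exact isClosed_le continuous_const (LinearMap.continuous_of_finiteDimensional _)

theorem K_convex (A : EJA J) : Convex ℝ A.K := by
  intro x hx y hy a b ha hb _
  exact A.K_add (A.K_smul ha hx) (A.K_smul hb hy)

theorem K_interior (A : EJA J) : (interior A.K).Nonempty := by
  rw [A.K_convex.interior_nonempty_iff_affineSpan_eq_top, eq_top_iff]
  intro x _
  obtain ⟨c, l, hc, rfl⟩ := A.exists_F x
  have hp : A.F c (fun j => max (l j) 0) ∈ A.K := by
    rw [A.F_mem_K hc]; intro j; positivity
  have hn : A.F c (fun j => max (-l j) 0) ∈ A.K := by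
    rw [A.F_mem_K hc]; intro j; positivity
  have h := AffineSubspace.smul_vsub_vadd_mem (affineSpan ℝ A.K) (1 : ℝ)
    (mem_affineSpan ℝ hp) (mem_affineSpan ℝ hn) (mem_affineSpan ℝ A.K_zero)
  convert h using 1
  rw [vsub_eq_sub, vadd_eq_add, add_zero, one_smul, A.F_sub]
  congr 1
  funext j
  simp only [Pi.sub_apply]
  rcases le_total 0 (l j) with h | h
  · rw [max_eq_left h, max_eq_right (by linarith)]; ring
  · rw [max_eq_right h, max_eq_left (by linarith)]; ring

theorem cone_closure (A : EJA J) : closure A.cone = A.K := by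
  show closure (interior A.K) = A.K
  rw [A.K_convex.closure_interior_eq_closure_of_nonempty_interior A.K_interior,
    A.K_closed.closure_eq]

theorem conePres_image (A : EJA J) (g : (J →L[ℝ] J)ˣ) (hg : g ∈ A.conePreserving) :
    (g : J →L[ℝ] J) '' A.K = A.K := by
  have h := (ContinuousLinearEquiv.ofUnit g).toHomeomorph.image_closure A.cone
  have h' : (ContinuousLinearEquiv.ofUnit g).toHomeomorph '' A.cone = A.cone := hg
  rw [h', cone_closure] at h
  exact h

theorem rank_cone (A : EJA J) (g : (J →L[ℝ] J)ˣ) (hg : g ∈ A.conePreserving) (u : J) (k : ℕ) :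
    A.HasRank ((g : J →L[ℝ] J) u) k ↔ A.HasRank u k := by
  have h := A.conePres_image g hg
  apply A.rank_map (ContinuousLinearEquiv.ofUnit g).toLinearEquiv
  · intro x hx
    rw [← h]
    exact ⟨x, hx, rfl⟩
  · intro x hx
    rw [← h] at hx
    obtain ⟨w, hw, rfl⟩ := hx
    have : (ContinuousLinearEquiv.ofUnit g).toLinearEquiv.symm ((g : J →L[ℝ] J) w) = w :=
      (ContinuousLinearEquiv.ofUnit g).symm_apply_apply w
    rwa [this]

end EJA

/-- For invertible `x, y ∈ J` (with Jordan inverses `xi`, `yi`),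
`x⁻¹ − y⁻¹` and `x − y` have the same rank.  Consequently the transversality index
`μ(x,y) = r − rank(x−y)` is invariant under the inversion `s(z) = −z⁻¹`, as it is under
translations and under the group `L` (identity component of the linear automorphisms of
the symmetric cone). -/
theorem EJA.rank_inv_sub_inv {J : Type} [NormedAddCommGroup J] [NormedSpace ℝ J]
    [FiniteDimensional ℝ J] (A : EJA J) (x y xi yi : J)
    (hx : A.IsInverse x xi) (hy : A.IsInverse y yi) :
    (∀ k : ℕ, A.HasRank (xi - yi) k ↔ A.HasRank (x - y) k) ∧
    (∀ k : ℕ, A.HasRank (-xi - -yi) k ↔ A.HasRank (x - y) k) ∧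
    (∀ x' y' u : J, ∀ k : ℕ, A.HasRank ((x' + u) - (y' + u)) k ↔ A.HasRank (x' - y') k) ∧
    (∀ x' y' : J, ∀ g ∈ A.Lgroup, ∀ k : ℕ,
      A.HasRank ((g : J →L[ℝ] J) x' - (g : J →L[ℝ] J) y') k ↔ A.HasRank (x' - y') k) := by
  have h1 : ∀ k : ℕ, A.HasRank (xi - yi) k ↔ A.HasRank (x - y) k :=
    A.rank_iff_of_le (A.rank_inv_le hx.inv hy.inv) (A.rank_inv_le hx.inv.symm hy.inv.symm)
  refine ⟨h1, ?_, ?_, ?_⟩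
  · intro k
    rw [← h1, show -xi - -yi = -(xi - yi) by abel]
    refine ⟨fun h => ?_, fun h => h.neg⟩
    have := h.neg
    rwa [neg_neg] at this
  · intro x' y' u k
    rw [add_sub_add_right_eq_sub]
  · intro x' y' g hg k
    obtain ⟨hg', _⟩ := hg
    rw [← map_sub]
    exact A.rank_cone g hg' _ k
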